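/- arXiv:math/0110211 — 3 statements merged into one kernel-verified Lean document; each statement's English description precedes it below -/
import Mathlib

section
/- For a simple convergent chip firing game with initial configuration σ₀, the map τ ↦ sh(τ) is a well-defined order isomorphism from the configuration space (reachable configurations ordered by reachability) onto the family of valid shot-sets ordered by inclusion. -/
/-- A chip firing game over vertex set `V` is given by an edge-multiplicity
function `E : V → V → ℕ`; `outdeg E v` is the out-degree of `v`. -/
def outdeg {V : Type*} [Fintype V] (E : V → V → ℕ) (v : V) : ℕ := ∑ w, E v w

/-- A vertex `v` is firable in the configuration `σ` if it holds at least
as many chips as its out-degree. -/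
def Firable {V : Type*} [Fintype V] (E : V → V → ℕ) (σ : V → ℕ) (v : V) : Prop :=
  outdeg E v ≤ σ v

/-- Firing the vertex `v` in the configuration `σ`. -/
def fire {V : Type*} [Fintype V] [DecidableEq V] (E : V → V → ℕ) (σ : V → ℕ) (v : V) :
    V → ℕ :=
  fun w => σ w + E v w - (if w = v then outdeg E v else 0)

/-- The configuration obtained from `σ` by firing the vertices of a list, in order. -/
def fireList {V : Type*} [Fintype V] [DecidableEq V] (E : V → V → ℕ) :
    (V → ℕ) → List V → (V → ℕ)
  | σ, [] => σ
  | σ, v :: l => fireList E (fire E σ v) l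

/-- A list of vertices is a valid firing sequence from `σ` if each vertex is
firable at the moment it is fired. -/
def ValidSeq {V : Type*} [Fintype V] [DecidableEq V] (E : V → V → ℕ) :
    (V → ℕ) → List V → Prop
  | _, [] => True
  | σ, v :: l => Firable E σ v ∧ ValidSeq E (fire E σ v) l

/-- `τ` is reachable from `σ` if some valid firing sequence leads from `σ` to `τ`. -/
def Reachable {V : Type*} [Fintype V] [DecidableEq V] (E : V → V → ℕ) (σ τ : V → ℕ) : Prop :=
  ∃ l : List V, ValidSeq E σ l ∧ fireList E σ l = τ

/-- A CFG with initial configuration `σ₀` is convergent if some configuration with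
no firable vertex is reachable from `σ₀`. -/
def Convergent {V : Type*} [Fintype V] [DecidableEq V] (E : V → V → ℕ) (σ₀ : V → ℕ) : Prop :=
  ∃ τ, Reachable E σ₀ τ ∧ ∀ v, ¬ Firable E τ v

/-- A CFG is simple if in every firing sequence starting from the initial
configuration, each vertex is fired at most once. -/
def SimpleCFG {V : Type*} [Fintype V] [DecidableEq V] (E : V → V → ℕ) (σ₀ : V → ℕ) : Prop :=
  ∀ l : List V, ValidSeq E σ₀ l → l.Nodup

/-- A subset `X ⊆ V` is a valid shot-set if it is the set of vertices fired along some
valid firing sequence from the initial configuration. -/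
def ValidShotSet {V : Type*} [Fintype V] [DecidableEq V] (E : V → V → ℕ) (σ₀ : V → ℕ)
    (X : Finset V) : Prop :=
  ∃ l : List V, ValidSeq E σ₀ l ∧ l.toFinset = X

section FiringSequences

variable {V : Type*} [Fintype V] [DecidableEq V] {E : V → V → ℕ} {σ σ₀ : V → ℕ}

theorem fireList_append (l m : List V) :
    fireList E σ (l ++ m) = fireList E (fireList E σ l) m := by
  induction l generalizing σ with
  | nil => rfl
  | cons v l ih => exact ih

theorem validSeq_append {l m : List V} :
    ValidSeq E σ (l ++ m) ↔ ValidSeq E σ l ∧ ValidSeq E (fireList E σ l) m := by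
  induction l generalizing σ with
  | nil => simp [ValidSeq, fireList]
  | cons v l ih => simp [ValidSeq, fireList, ih, and_assoc]

/-- Conservation of chips at `w` along a valid firing sequence. -/
theorem ValidSeq.fireList_add_count_mul {l : List V} (h : ValidSeq E σ l) (w : V) :
    fireList E σ l w + l.count w * outdeg E w = σ w + (l.map fun u => E u w).sum := by
  induction l generalizing σ with
  | nil => simp [fireList]
  | cons v l ih =>
    obtain ⟨hv, hl⟩ := h
    have key := ih hl
    have hstep : fire E σ v w + (if w = v then outdeg E v else 0) = σ w + E v w := by
      unfold fire
      unfold Firable at hv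
      split_ifs with hw
      · subst hw; omega
      · omega
    rw [fireList, List.map_cons, List.sum_cons, List.count_cons, add_mul]
    by_cases hw : w = v
    · subst hw
      simp only [if_true, beq_self_eq_true, one_mul] at hstep ⊢
      omega
    · have hw' : ¬ v = w := fun h => hw h.symm
      simp only [hw, hw', if_false, beq_iff_eq, zero_mul] at hstep ⊢
      omega

theorem ValidSeq.fireList_eq_of_perm {l m : List V} (hl : ValidSeq E σ l)
    (hm : ValidSeq E σ m) (h : l.Perm m) : fireList E σ l = fireList E σ m := by
  funext w
  have h₁ := hl.fireList_add_count_mul w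
  have h₂ := hm.fireList_add_count_mul w
  rw [h.count_eq, (h.map _).sum_eq] at h₁
  omega

/-- A vertex gains chips as long as it is not fired. -/
theorem ValidSeq.fireList_le_of_subset {k l : List V} {v : V} (hk : ValidSeq E σ k)
    (hl : ValidSeq E σ l) (hnd : k.Nodup) (hkl : k ⊆ l) (hv : v ∉ l) :
    fireList E σ k v ≤ fireList E σ l v := by
  have h₁ := hk.fireList_add_count_mul v
  have h₂ := hl.fireList_add_count_mul v
  rw [List.count_eq_zero_of_not_mem hv] at h₂
  obtain ⟨k', hperm, hsub⟩ := hnd.subperm hkl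
  have h₃ := (hsub.map fun u => E u v).sum_le_sum (by simp)
  rw [(hperm.map _).sum_eq] at h₃
  omega

/-- In a simple game, a valid firing sequence can be extended by the vertices of another one
that it has not fired yet. -/
theorem SimpleCFG.exists_extension (hs : SimpleCFG E σ₀) {l l' : List V}
    (hl : ValidSeq E σ₀ l) (hl' : ValidSeq E σ₀ l') :
    ∃ m, ValidSeq E σ₀ (l ++ m) ∧ ∀ x, x ∈ l ++ m ↔ x ∈ l ∨ x ∈ l' := by
  induction l' using List.reverseRecOn with
  | nil => exact ⟨[], by simpa using hl, by simp⟩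
  | append_singleton k v ih =>
    obtain ⟨hk, hv⟩ := validSeq_append.1 hl'
    obtain ⟨m, hm, hmem⟩ := ih hk
    by_cases hvm : v ∈ l ++ m
    · refine ⟨m, hm, fun x => ?_⟩
      by_cases hx : x = v
      · subst hx; simp [hvm]
      · simp [hmem, hx]
    · refine ⟨m ++ [v], ?_, fun x => ?_⟩
      · rw [← List.append_assoc]
        refine validSeq_append.2 ⟨hm, le_trans hv.1 ?_, trivial⟩
        exact hk.fireList_le_of_subset hm (hs k hk) (fun x hx => (hmem x).2 (.inr hx)) hvm
      · rw [← List.append_assoc, List.mem_append, hmem, List.mem_append, or_assoc]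

theorem SimpleCFG.subset_of_fireList_eq (hs : SimpleCFG E σ₀) {l l' : List V}
    (hl : ValidSeq E σ₀ l) (hl' : ValidSeq E σ₀ l')
    (h : fireList E σ₀ l = fireList E σ₀ l') : l' ⊆ l := by
  obtain ⟨m, hm, hmem⟩ := hs.exists_extension hl hl'
  have hm' : ValidSeq E σ₀ (l' ++ m) :=
    validSeq_append.2 ⟨hl', h ▸ (validSeq_append.1 hm).2⟩
  intro x hx
  rcases List.mem_append.1 ((hmem x).2 (.inr hx)) with hxl | hxm
  · exact hxl
  · exact absurd hxm (List.disjoint_of_nodup_append (hs _ hm') hx)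

theorem SimpleCFG.toFinset_eq_of_fireList_eq (hs : SimpleCFG E σ₀) {l l' : List V}
    (hl : ValidSeq E σ₀ l) (hl' : ValidSeq E σ₀ l')
    (h : fireList E σ₀ l = fireList E σ₀ l') : l.toFinset = l'.toFinset :=
  List.toFinset.ext fun _ =>
    ⟨fun hx => hs.subset_of_fireList_eq hl' hl h.symm hx,
      fun hx => hs.subset_of_fireList_eq hl hl' h hx⟩

theorem SimpleCFG.fireList_eq_of_toFinset_eq (hs : SimpleCFG E σ₀) {l l' : List V}
    (hl : ValidSeq E σ₀ l) (hl' : ValidSeq E σ₀ l')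
    (h : l.toFinset = l'.toFinset) : fireList E σ₀ l = fireList E σ₀ l' :=
  hl.fireList_eq_of_perm hl' (List.perm_of_nodup_nodup_toFinset_eq (hs l hl) (hs l' hl') h)

theorem SimpleCFG.reachable_fireList_iff (hs : SimpleCFG E σ₀) {l l' : List V}
    (hl : ValidSeq E σ₀ l) (hl' : ValidSeq E σ₀ l') :
    Reachable E (fireList E σ₀ l) (fireList E σ₀ l') ↔ l.toFinset ⊆ l'.toFinset := by
  constructor
  · rintro ⟨m, hm, hmeq⟩
    rw [← fireList_append] at hmeq
    rw [← hs.toFinset_eq_of_fireList_eq (validSeq_append.2 ⟨hl, hm⟩) hl' hmeq]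
    exact List.toFinset_append (l := l) (l' := m) ▸ Finset.subset_union_left
  · intro h
    obtain ⟨m, hm, hmem⟩ := hs.exists_extension hl hl'
    refine ⟨m, (validSeq_append.1 hm).2, ?_⟩
    rw [← fireList_append]
    refine hs.fireList_eq_of_toFinset_eq hm hl' ?_
    ext x
    have hx := @h x
    rw [List.mem_toFinset, List.mem_toFinset] at *
    rw [hmem]
    exact or_iff_right_of_imp hx

end FiringSequences

/-- for a simple convergent CFG, the map `τ ↦ sh τ` is a well-defined order
isomorphism from the configuration space (reachable configurations ordered by
reachability) onto the family of valid shot-sets ordered by inclusion.  Well-definedness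
is expressed by the first clause: the image of `τ` is `l.toFinset` for every valid firing
sequence `l` leading from `σ₀` to `τ`. -/
theorem shotSet_orderIso {V : Type*} [Fintype V] [DecidableEq V]
    (E : V → V → ℕ) (σ₀ : V → ℕ) (hconv : Convergent E σ₀) (hsimple : SimpleCFG E σ₀) :
    ∃ e : {τ : V → ℕ // Reachable E σ₀ τ} ≃ {X : Finset V // ValidShotSet E σ₀ X},
      (∀ (τ : {τ : V → ℕ // Reachable E σ₀ τ}) (l : List V),
        ValidSeq E σ₀ l → fireList E σ₀ l = τ.val → (e τ).val = l.toFinset) ∧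
      (∀ τ₁ τ₂ : {τ : V → ℕ // Reachable E σ₀ τ},
        Reachable E τ₁.val τ₂.val ↔ (e τ₁).val ⊆ (e τ₂).val) := by
  classical
  choose seq hseq hfire using fun τ : {τ : V → ℕ // Reachable E σ₀ τ} => τ.2
  let sh : {τ : V → ℕ // Reachable E σ₀ τ} → {X : Finset V // ValidShotSet E σ₀ X} :=
    fun τ => ⟨(seq τ).toFinset, seq τ, hseq τ, rfl⟩
  have hsh : Function.Bijective sh := by
    constructor
    · intro τ₁ τ₂ h
      apply Subtype.ext
      rw [← hfire τ₁, ← hfire τ₂]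
      exact hsimple.fireList_eq_of_toFinset_eq (hseq τ₁) (hseq τ₂) (congrArg Subtype.val h)
    · rintro ⟨X, l, hl, rfl⟩
      exact ⟨⟨fireList E σ₀ l, l, hl, rfl⟩, Subtype.ext <|
        hsimple.toFinset_eq_of_fireList_eq (hseq _) hl (hfire _)⟩
  refine ⟨Equiv.ofBijective sh hsh, fun τ l hl hτ => ?_, fun τ₁ τ₂ => ?_⟩
  · exact hsimple.toFinset_eq_of_fireList_eq (hseq τ) hl ((hfire τ).trans hτ.symm)
  · have h := hsimple.reachable_fireList_iff (hseq τ₁) (hseq τ₂)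
    rwa [hfire, hfire] at h
end

section
/- There exists a finite upper locally distributive lattice L such that no convergent chip firing game has a configuration space order-isomorphic to L. -/
/-- A preordered type is (order-isomorphic to) the configuration space of a convergent
chip firing game if there is a convergent CFG and an equivalence with its set of
reachable configurations under which the order corresponds to reachability. -/
def CFGSpace (α : Type*) [Preorder α] : Prop :=
  ∃ (V : Type) (iF : Fintype V) (iD : DecidableEq V) (E : V → V → ℕ) (σ₀ : V → ℕ),
    Convergent E σ₀ ∧
    ∃ e : α ≃ {τ : V → ℕ // Reachable E σ₀ τ},
      ∀ x y : α, x ≤ y ↔ Reachable E (e x).val (e y).val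

open Classical in
/-- The join of all upper covers of `x` (equal to `x` itself when `x` has no upper
cover). -/
noncomputable def covJoin {L : Type*} [Lattice L] [Fintype L] (x : L) : L :=
  (insert x (Finset.univ.filter (fun y => x ⋖ y))).sup' (Finset.insert_nonempty _ _) id

/-- A finite lattice is upper locally distributive (ULD) if for every `x`, the interval
between `x` and the join of all upper covers of `x` is order-isomorphic to the powerset
(ordered by inclusion) of the set of upper covers of `x`. -/
def IsULD (L : Type*) [Lattice L] [Fintype L] : Prop :=
  ∀ x : L, Nonempty ((Set.Icc x (covJoin x)) ≃o Set {y : L // x ⋖ y})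

section Firing

variable {V : Type*} [Fintype V] [DecidableEq V] {E : V → V → ℕ}

theorem Reachable.refl (σ : V → ℕ) : Reachable E σ σ := ⟨[], trivial, rfl⟩

theorem Reachable.head {σ τ : V → ℕ} {v : V} (hv : Firable E σ v)
    (h : Reachable E (fire E σ v) τ) : Reachable E σ τ := by
  obtain ⟨l, hl, rfl⟩ := h
  exact ⟨v :: l, ⟨hv, hl⟩, rfl⟩

/-- Induction along a firing sequence with fixed final configuration. -/
theorem Reachable.head_induction {τ : V → ℕ} {P : (V → ℕ) → Prop} (refl : P τ)
    (head : ∀ σ v, Firable E σ v → Reachable E (fire E σ v) τ → P (fire E σ v) → P σ)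
    {σ : V → ℕ} (h : Reachable E σ τ) : P σ := by
  obtain ⟨l, hl, hτ⟩ := h
  induction l generalizing σ with
  | nil => cases hτ; exact refl
  | cons v l ih => exact head σ v hl.1 ⟨l, hl.2, hτ⟩ (ih hl.2 hτ)

theorem Reachable.trans {σ τ ρ : V → ℕ} (h : Reachable E σ τ) (h' : Reachable E τ ρ) :
    Reachable E σ ρ :=
  h.head_induction (P := fun σ => Reachable E σ ρ) h' fun _ _ hv _ ih => ih.head hv

theorem Firable.reachable {σ : V → ℕ} {v : V} (hv : Firable E σ v) :
    Reachable E σ (fire E σ v) :=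
  (Reachable.refl _).head hv

theorem fire_apply_self (σ : V → ℕ) (v : V) :
    fire E σ v v = σ v + E v v - outdeg E v := by
  simp [fire]

theorem fire_apply_of_ne (σ : V → ℕ) {v w : V} (h : w ≠ v) :
    fire E σ v w = σ w + E v w := by
  simp [fire, h]

theorem Firable.fire {σ : V → ℕ} {u v : V} (hv : Firable E σ v) (h : v ≠ u) :
    Firable E (fire E σ u) v := by
  unfold Firable at *
  rw [fire_apply_of_ne σ h]
  omega

theorem fire_comm {σ : V → ℕ} {u v : V} (hu : Firable E σ u) (hv : Firable E σ v) (h : u ≠ v) :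
    fire E (fire E σ u) v = fire E (fire E σ v) u := by
  unfold Firable at *
  funext w
  by_cases hwu : w = u
  · subst hwu
    rw [fire_apply_of_ne _ h, fire_apply_self, fire_apply_self, fire_apply_of_ne _ h]
    omega
  · by_cases hwv : w = v
    · subst hwv
      rw [fire_apply_self, fire_apply_of_ne _ hwu, fire_apply_of_ne _ hwu, fire_apply_self]
      omega
    · simp only [fire_apply_of_ne _ hwu, fire_apply_of_ne _ hwv]
      omega

theorem fire_eq_self {σ : V → ℕ} {v : V} (h : outdeg E v ≤ E v v) : fire E σ v = σ := by
  have hs : outdeg E v = E v v + ∑ w ∈ Finset.univ.erase v, E v w :=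
    (Finset.add_sum_erase _ _ (Finset.mem_univ v)).symm
  have h0 : ∑ w ∈ Finset.univ.erase v, E v w = 0 := by omega
  funext w
  by_cases hw : w = v
  · subst hw
    rw [fire_apply_self]
    omega
  · rw [fire_apply_of_ne _ hw, Finset.sum_eq_zero_iff.1 h0 w (by simp [hw]), Nat.add_zero]

theorem Firable.fire_injective {σ τ : V → ℕ} {v : V} (hσ : Firable E σ v) (hτ : Firable E τ v)
    (h : _root_.fire E σ v = _root_.fire E τ v) : σ = τ := by
  unfold Firable at *
  funext w
  have hw := congrFun h w
  by_cases hwv : w = v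
  · subst hwv
    rw [fire_apply_self, fire_apply_self] at hw
    omega
  · rw [fire_apply_of_ne _ hwv, fire_apply_of_ne _ hwv] at hw
    omega

/-- A firing that changes the configuration determines the fired vertex. -/
theorem eq_of_fire_eq {σ : V → ℕ} {u v : V} (hu : Firable E σ u)
    (hne : fire E σ u ≠ σ) (h : fire E σ u = fire E σ v) : u = v := by
  by_contra huv
  unfold Firable at hu
  have hw := congrFun h u
  rw [fire_apply_self, fire_apply_of_ne _ huv] at hw
  exact hne (fire_eq_self (by omega))

/-- Local confluence of a single firing with a firing sequence. -/
theorem Reachable.exchange {σ τ : V → ℕ} (h : Reachable E σ τ) {v : V} (hv : Firable E σ v) :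
    Reachable E (fire E σ v) τ ∨
      (σ v ≤ τ v ∧ Reachable E (fire E σ v) (fire E τ v)) := by
  revert hv
  refine h.head_induction (P := fun σ => Firable E σ v → Reachable E (fire E σ v) τ ∨
      (σ v ≤ τ v ∧ Reachable E (fire E σ v) (fire E τ v)))
    (fun _ => Or.inr ⟨le_rfl, Reachable.refl _⟩) ?_
  intro σ u hu hr ih hv
  by_cases huv : u = v
  · subst huv
    exact Or.inl hr
  · have hc := fire_comm hu hv huv
    have hu' : Firable E (fire E σ v) u := hu.fire huv
    rcases ih (hv.fire (Ne.symm huv)) with h | ⟨h, h'⟩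
    · exact Or.inl (Reachable.head hu' (hc ▸ h))
    · refine Or.inr ⟨le_trans ?_ h, Reachable.head hu' (hc ▸ h')⟩
      rw [fire_apply_of_ne _ (Ne.symm huv)]
      omega

theorem Reachable.exists_fire {σ τ : V → ℕ} (h : Reachable E σ τ) (hne : σ ≠ τ) :
    ∃ v, Firable E σ v ∧ fire E σ v ≠ σ ∧ Reachable E (fire E σ v) τ := by
  revert hne
  refine h.head_induction (P := fun σ => σ ≠ τ →
    ∃ v, Firable E σ v ∧ fire E σ v ≠ σ ∧ Reachable E (fire E σ v) τ)
    (fun h => absurd rfl h) ?_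
  intro σ v hv hr ih hne
  by_cases h : fire E σ v = σ
  · rw [h] at ih
    exact ih hne
  · exact ⟨v, hv, h, hr⟩

end Firing

section Labelling

variable {V : Type*} [Fintype V] [DecidableEq V] {E : V → V → ℕ} {σ₀ : V → ℕ}
  {L : Type*}

/-- Firing `v` at the configuration labelled by `x` yields the one labelled by `y`. -/
def Step (e : L ≃ {τ : V → ℕ // Reachable E σ₀ τ}) (x : L) (v : V) (y : L) : Prop :=
  Firable E (e x).val v ∧ (e y).val = fire E (e x).val v

variable {e : L ≃ {τ : V → ℕ // Reachable E σ₀ τ}}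

theorem Step.unique {x y z : L} {v : V} (h : Step e x v y) (h' : Step e x v z) : y = z :=
  e.injective (Subtype.ext (h.2.trans h'.2.symm))

theorem Step.vertex_unique {x y : L} {u v : V} (h : Step e x u y) (h' : Step e x v y)
    (hne : x ≠ y) : u = v := by
  refine eq_of_fire_eq h.1 (fun h0 => hne ?_) (h.2.symm.trans h'.2)
  exact e.injective (Subtype.ext (h0.symm.trans h.2.symm))

theorem Step.ne_of_ne {x y x' y' : L} {v : V} (h : Step e x v y) (h' : Step e x' v y')
    (hne : x ≠ y) : x' ≠ y' := by
  rintro rfl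
  apply hne
  have h1 := congrFun h'.2 v
  have h2 := h'.1
  unfold Firable at h2
  rw [fire_apply_self] at h1
  exact e.injective (Subtype.ext ((fire_eq_self (by omega)).symm.trans h.2.symm))

theorem exists_step_of_firable {x : L} {v : V} (h : Firable E (e x).val v) :
    ∃ y, Step e x v y := by
  refine ⟨e.symm ⟨fire E (e x).val v, (e x).2.trans h.reachable⟩, h, ?_⟩
  simp

variable [Lattice L] (he : ∀ x y : L, x ≤ y ↔ Reachable E (e x).val (e y).val)
include he

theorem exists_step_of_covBy {x y : L} (h : x ⋖ y) : ∃ v, Step e x v y := by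
  obtain ⟨v, hv, hne, hr⟩ := ((he x y).1 h.le).exists_fire
    (fun h' => h.ne (e.injective (Subtype.ext h')))
  obtain ⟨z, hz⟩ := exists_step_of_firable hv
  refine ⟨v, ?_⟩
  have hxz : x ≤ z := (he x z).2 (hz.2 ▸ hv.reachable)
  have hzy : z ≤ y := (he z y).2 (hz.2 ▸ hr)
  have hxz' : x ≠ z := by
    rintro rfl
    exact hne hz.2.symm
  rwa [← (h.wcovBy.eq_or_eq hxz hzy).resolve_left (Ne.symm hxz')]

theorem Step.wcovBy {x y : L} {v : V} (h : Step e x v y) : x ⩿ y := by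
  have hxy : x ≤ y := (he x y).2 (h.2 ▸ h.1.reachable)
  refine wcovBy_of_eq_or_eq hxy fun z hxz hzy => ?_
  rcases ((he x z).1 hxz).exchange h.1 with hr | ⟨hle, hr⟩
  · exact Or.inr (le_antisymm hzy ((he y z).2 (h.2 ▸ hr)))
  have hzv : Firable E (e z).val v := le_trans h.1 hle
  obtain ⟨w, hw⟩ := exists_step_of_firable hzv
  rcases ((he z y).1 hzy).exchange hzv with hr' | ⟨hle', -⟩
  · have hyw : y = w := le_antisymm ((he y w).2 (by rw [h.2, hw.2]; exact hr))
      ((he w y).2 (by rw [hw.2]; exact hr'))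
    subst hyw
    exact Or.inl (e.injective (Subtype.ext (hzv.fire_injective h.1 (hw.2.symm.trans h.2))))
  · have hv := h.1
    unfold Firable at hv
    have h1 := congrFun h.2 v
    rw [fire_apply_self] at h1
    have hyx : y = x := e.injective (Subtype.ext (h.2.trans (fire_eq_self (by omega))))
    exact Or.inl (le_antisymm (hyx ▸ hzy) hxz)

theorem Step.sup {x y z w : L} {u v : V} (hu : Step e x u y) (hv : Step e x v z)
    (hxz : x ≠ z) (hyz : y ≠ z) (hw : y ⊔ z = w) : Step e y v w := by
  have huv : u ≠ v := by
    rintro rfl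
    exact hyz (hu.unique hv)
  have hy : Firable E (e y).val v := by
    rw [hu.2]
    exact hv.1.fire (Ne.symm huv)
  obtain ⟨t, ht⟩ := exists_step_of_firable hy
  have hyt := ht.wcovBy he
  have hzt : z ≤ t := by
    rw [he, ht.2, hu.2, fire_comm hu.1 hv.1 huv, hv.2]
    exact (hu.1.fire huv).reachable
  rcases hyt.eq_or_eq le_sup_left (sup_le hyt.le hzt) with h | h
  · rcases (hu.wcovBy he).eq_or_eq (hv.wcovBy he).le (sup_eq_left.1 h) with h' | h'
    · exact absurd h'.symm hxz
    · exact absurd h'.symm hyz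
  · rwa [← hw, h]

end Labelling

/-- The feasible sets of the antimatroid on `Fin 5` in which `0, 1, 2, 3` are free and `4` is
enabled by `{0, 1}` and by `{2, 3}`. -/
def Feasible (s : Finset (Fin 5)) : Prop :=
  4 ∈ s → ({0, 1} ⊆ s ∨ {2, 3} ⊆ s)

instance : DecidablePred Feasible := fun s => by
  unfold Feasible
  infer_instance

/-- The lattice of feasible sets. -/
abbrev FeasibleSet : Type := {s : Finset (Fin 5) // Feasible s}

theorem Feasible.union {s t : Finset (Fin 5)} (hs : Feasible s) (ht : Feasible t) :
    Feasible (s ∪ t) := by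
  intro h
  rcases Finset.mem_union.1 h with h | h
  · exact (hs h).imp (fun h => h.trans Finset.subset_union_left)
      (fun h => h.trans Finset.subset_union_left)
  · exact (ht h).imp (fun h => h.trans Finset.subset_union_right)
      (fun h => h.trans Finset.subset_union_right)

theorem Feasible.insert_of_ne {s : Finset (Fin 5)} (hs : Feasible s) {i : Fin 5} (hi : i ≠ 4) :
    Feasible (insert i s) := by
  intro h
  exact (hs ((Finset.mem_insert.1 h).resolve_left (Ne.symm hi))).imp
    (fun h => h.trans (Finset.subset_insert _ _)) (fun h => h.trans (Finset.subset_insert _ _))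

/-- The largest feasible subset of a set. -/
def feasibleInterior (s : Finset (Fin 5)) : Finset (Fin 5) :=
  s.filter fun i => i = 4 → ({0, 1} ⊆ s ∨ {2, 3} ⊆ s)

theorem feasible_interior (s : Finset (Fin 5)) : Feasible (feasibleInterior s) := by
  revert s
  decide

theorem Feasible.subset_interior {s t : Finset (Fin 5)} (hs : Feasible s) (h : s ⊆ t) :
    s ⊆ feasibleInterior t := by
  intro i hi
  refine Finset.mem_filter.2 ⟨h hi, ?_⟩
  rintro rfl
  exact (hs hi).imp (fun h' => h'.trans h) (fun h' => h'.trans h)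

instance : Lattice FeasibleSet where
  sup x y := ⟨x.1 ∪ y.1, x.2.union y.2⟩
  inf x y := ⟨feasibleInterior (x.1 ∩ y.1), feasible_interior _⟩
  le_sup_left _ _ := Finset.subset_union_left
  le_sup_right _ _ := Finset.subset_union_right
  sup_le _ _ _ h h' := Finset.union_subset h h'
  inf_le_left _ _ := (Finset.filter_subset _ _).trans Finset.inter_subset_left
  inf_le_right _ _ := (Finset.filter_subset _ _).trans Finset.inter_subset_right
  le_inf x _ _ h h' := x.2.subset_interior (Finset.subset_inter h h')

namespace FeasibleSet

theorem mem_sup' {T : Finset FeasibleSet} (hT : T.Nonempty) (i : Fin 5) :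
    i ∈ (T.sup' hT id).1 ↔ ∃ c ∈ T, i ∈ c.1 := by
  have h : (T.sup' hT id).1 = T.sup' hT Subtype.val :=
    Finset.apply_sup'_eq_sup'_comp hT Subtype.val (fun _ _ => rfl)
  rw [h, Finset.sup'_eq_sup, Finset.mem_sup]

theorem covBy_of_eq_insert {x y : FeasibleSet} {i : Fin 5} (hi : i ∉ x.1)
    (h : y.1 = insert i x.1) : x ⋖ y := by
  have hc : x.1 ⋖ y.1 := h ▸ Finset.covBy_insert hi
  exact ⟨hc.1, fun z hz hz' => hc.2 hz hz'⟩

theorem exists_insert_of_lt {x y : FeasibleSet} (h : x < y) :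
    ∃ i ∈ y.1, i ∉ x.1 ∧ Feasible (insert i x.1) := by
  by_cases hi : ∃ i ∈ y.1, i ∉ x.1 ∧ i ≠ 4
  · obtain ⟨i, hy, hx, h4⟩ := hi
    exact ⟨i, hy, hx, x.2.insert_of_ne h4⟩
  · push Not at hi
    obtain ⟨i, hy, hx⟩ := Finset.exists_of_ssubset (show x.1 ⊂ y.1 from h)
    refine ⟨i, hy, hx, ?_⟩
    have hxy : insert i x.1 = y.1 := by
      refine Finset.Subset.antisymm (Finset.insert_subset hy h.le) fun j hj => ?_
      by_cases hjx : j ∈ x.1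
      · exact Finset.mem_insert_of_mem hjx
      · rw [hi j hj hjx, hi i hy hx]
        exact Finset.mem_insert_self _ _
    rw [hxy]
    exact y.2

theorem exists_eq_insert_of_covBy {x y : FeasibleSet} (h : x ⋖ y) :
    ∃ i, i ∉ x.1 ∧ y.1 = insert i x.1 := by
  obtain ⟨i, hy, hx, hf⟩ := exists_insert_of_lt h.lt
  refine ⟨i, hx, ?_⟩
  let z : FeasibleSet := ⟨insert i x.1, hf⟩
  have hxz : x ⋖ z := covBy_of_eq_insert hx rfl
  have hzy : z ≤ y := Finset.insert_subset hy h.le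
  rw [← (h.wcovBy.eq_or_eq hxz.le hzy).resolve_left hxz.ne']

/-- Distinct upper covers of `x` share no point outside `x`. -/
theorem eq_of_mem_of_covBy {x y z : FeasibleSet} (hy : x ⋖ y) (hz : x ⋖ z) {i : Fin 5}
    (hi : i ∉ x.1) (hiy : i ∈ y.1) (hiz : i ∈ z.1) : y = z := by
  obtain ⟨j, -, hj⟩ := exists_eq_insert_of_covBy hy
  obtain ⟨k, -, hk⟩ := exists_eq_insert_of_covBy hz
  rw [hj] at hiy
  rw [hk] at hiz
  apply Subtype.ext
  rw [hj, hk, ← (Finset.mem_insert.1 hiy).resolve_right hi,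
    ← (Finset.mem_insert.1 hiz).resolve_right hi]

theorem isULD : IsULD FeasibleSet := by
  classical
  intro x
  have hmem : ∀ i, i ∈ (covJoin x).1 ↔ i ∈ x.1 ∨ ∃ c, x ⋖ c ∧ i ∈ c.1 := by
    intro i
    rw [covJoin, mem_sup']
    simp
  let f : Set.Icc x (covJoin x) → Set {y : FeasibleSet // x ⋖ y} := fun y => {c | c.1 ≤ y.1}
  have hf : ∀ y z, f y ≤ f z ↔ y ≤ z := by
    intro y z
    refine ⟨fun h i hi => ?_, fun h c (hc : c.1 ≤ y.1) => hc.trans h⟩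
    by_cases hix : i ∈ x.1
    · exact z.2.1 hix
    · obtain ⟨c, hc, hic⟩ := ((hmem i).1 (y.2.2 hi)).resolve_left hix
      have hcy : c ≤ y.1 := by
        obtain ⟨j, -, hj⟩ := exists_eq_insert_of_covBy hc
        have hij : i = j := (Finset.mem_insert.1 (hj ▸ hic)).resolve_right hix
        intro k hk
        rcases Finset.mem_insert.1 (hj ▸ hk) with rfl | hk
        · exact hij ▸ hi
        · exact y.2.1 hk
      exact (h (show (⟨c, hc⟩ : {y : FeasibleSet // x ⋖ y}) ∈ f y from hcy) : c ≤ z.1) hic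
  have hsurj : Function.Surjective f := by
    intro s
    let T : Finset FeasibleSet := insert x (Finset.univ.filter fun c => ∃ h : x ⋖ c, ⟨c, h⟩ ∈ s)
    have hT : T.Nonempty := Finset.insert_nonempty _ _
    have hmemT : ∀ i, i ∈ (T.sup' hT id).1 ↔
        i ∈ x.1 ∨ ∃ c, (∃ h : x ⋖ c, ⟨c, h⟩ ∈ s) ∧ i ∈ c.1 := by
      intro i
      rw [mem_sup']
      simp [T]
    refine ⟨⟨T.sup' hT id, fun i hi => (hmemT i).2 (Or.inl hi), fun i hi => (hmem i).2 ?_⟩, ?_⟩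
    · exact ((hmemT i).1 hi).imp_right fun ⟨c, ⟨h, _⟩, hi⟩ => ⟨c, h, hi⟩
    · ext ⟨c, hc⟩
      constructor
      · intro (h : c ≤ T.sup' hT id)
        obtain ⟨i, hix, hi⟩ := exists_eq_insert_of_covBy hc
        have hic : i ∈ c.1 := hi ▸ Finset.mem_insert_self _ _
        obtain ⟨d, ⟨hd, hds⟩, hid⟩ := ((hmemT i).1 (h hic)).resolve_left hix
        obtain rfl := eq_of_mem_of_covBy hc hd hix hic hid
        exact hds
      · intro h
        show c ≤ T.sup' hT id
        exact fun i hi => (hmemT i).2 (Or.inr ⟨c, ⟨hc, h⟩, hi⟩)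
  have hinj : Function.Injective f := fun y z h =>
    le_antisymm ((hf y z).1 h.le) ((hf z y).1 h.ge)
  exact ⟨⟨Equiv.ofBijective f ⟨hinj, hsurj⟩, fun {y z} => hf y z⟩⟩

theorem not_CFGSpace : ¬ CFGSpace FeasibleSet := by
  rintro ⟨V, _, _, E, σ₀, -, e, he⟩
  let O : FeasibleSet := ⟨∅, by decide⟩
  let A : FeasibleSet := ⟨{0}, by decide⟩
  let B : FeasibleSet := ⟨{1}, by decide⟩
  let C : FeasibleSet := ⟨{2}, by decide⟩
  let D : FeasibleSet := ⟨{3}, by decide⟩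
  let AB : FeasibleSet := ⟨{0, 1}, by decide⟩
  let AC : FeasibleSet := ⟨{0, 2}, by decide⟩
  let AD : FeasibleSet := ⟨{0, 3}, by decide⟩
  let BC : FeasibleSet := ⟨{1, 2}, by decide⟩
  let BD : FeasibleSet := ⟨{1, 3}, by decide⟩
  let CD : FeasibleSet := ⟨{2, 3}, by decide⟩
  let ABC : FeasibleSet := ⟨{0, 1, 2}, by decide⟩
  let ABD : FeasibleSet := ⟨{0, 1, 3}, by decide⟩
  let ACD : FeasibleSet := ⟨{0, 2, 3}, by decide⟩
  let BCD : FeasibleSet := ⟨{1, 2, 3}, by decide⟩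
  let ABCD : FeasibleSet := ⟨{0, 1, 2, 3}, by decide⟩
  let ABM : FeasibleSet := ⟨{0, 1, 4}, by decide⟩
  let CDM : FeasibleSet := ⟨{2, 3, 4}, by decide⟩
  let ABCM : FeasibleSet := ⟨{0, 1, 2, 4}, by decide⟩
  let ACDM : FeasibleSet := ⟨{0, 2, 3, 4}, by decide⟩
  let ABCDM : FeasibleSet := ⟨{0, 1, 2, 3, 4}, by decide⟩
  obtain ⟨a, hO_a⟩ : ∃ v, Step e O v A :=
    exists_step_of_covBy he (covBy_of_eq_insert (i := 0) (by decide) (by decide))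
  obtain ⟨b, hO_b⟩ : ∃ v, Step e O v B :=
    exists_step_of_covBy he (covBy_of_eq_insert (i := 1) (by decide) (by decide))
  obtain ⟨c, hO_c⟩ : ∃ v, Step e O v C :=
    exists_step_of_covBy he (covBy_of_eq_insert (i := 2) (by decide) (by decide))
  obtain ⟨d, hO_d⟩ : ∃ v, Step e O v D :=
    exists_step_of_covBy he (covBy_of_eq_insert (i := 3) (by decide) (by decide))
  have hA_b : Step e A b AB :=
    Step.sup he hO_a hO_b (by decide) (by decide) (by decide)
  have hA_c : Step e A c AC :=
    Step.sup he hO_a hO_c (by decide) (by decide) (by decide)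
  have hAB_c : Step e AB c ABC :=
    Step.sup he hA_b hA_c (by decide) (by decide) (by decide)
  have hA_d : Step e A d AD :=
    Step.sup he hO_a hO_d (by decide) (by decide) (by decide)
  have hAB_d : Step e AB d ABD :=
    Step.sup he hA_b hA_d (by decide) (by decide) (by decide)
  have hABC_d : Step e ABC d ABCD :=
    Step.sup he hAB_c hAB_d (by decide) (by decide) (by decide)
  have hC_d : Step e C d CD :=
    Step.sup he hO_c hO_d (by decide) (by decide) (by decide)
  have hC_a : Step e C a AC :=
    Step.sup he hO_c hO_a (by decide) (by decide) (by decide)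
  have hCD_a : Step e CD a ACD :=
    Step.sup he hC_d hC_a (by decide) (by decide) (by decide)
  have hC_b : Step e C b BC :=
    Step.sup he hO_c hO_b (by decide) (by decide) (by decide)
  have hCD_b : Step e CD b BCD :=
    Step.sup he hC_d hC_b (by decide) (by decide) (by decide)
  have hAC_b : Step e AC b ABC :=
    Step.sup he hA_c hA_b (by decide) (by decide) (by decide)
  have hAC_d : Step e AC d ACD :=
    Step.sup he hA_c hA_d (by decide) (by decide) (by decide)
  have hB_d : Step e B d BD :=
    Step.sup he hO_b hO_d (by decide) (by decide) (by decide)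
  have hB_a : Step e B a AB :=
    Step.sup he hO_b hO_a (by decide) (by decide) (by decide)
  have hBD_a : Step e BD a ABD :=
    Step.sup he hB_d hB_a (by decide) (by decide) (by decide)
  have hB_c : Step e B c BC :=
    Step.sup he hO_b hO_c (by decide) (by decide) (by decide)
  have hBD_c : Step e BD c BCD :=
    Step.sup he hB_d hB_c (by decide) (by decide) (by decide)
  have hACD_b : Step e ACD b ABCD :=
    Step.sup he hCD_a hCD_b (by decide) (by decide) (by decide)
  obtain ⟨v, hAB_v⟩ : ∃ v, Step e AB v ABM :=
    exists_step_of_covBy he (covBy_of_eq_insert (i := 4) (by decide) (by decide))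
  obtain ⟨w, hCD_w⟩ : ∃ v, Step e CD v CDM :=
    exists_step_of_covBy he (covBy_of_eq_insert (i := 4) (by decide) (by decide))
  have hABC_v : Step e ABC v ABCM :=
    Step.sup he hAB_c hAB_v (by decide) (by decide) (by decide)
  have hABCD_v : Step e ABCD v ABCDM :=
    Step.sup he hABC_d hABC_v (by decide) (by decide) (by decide)
  have hACD_w : Step e ACD w ACDM :=
    Step.sup he hCD_a hCD_w (by decide) (by decide) (by decide)
  have hABCD_w : Step e ABCD w ABCDM :=
    Step.sup he hACD_b hACD_w (by decide) (by decide) (by decide)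
  obtain rfl : v = w := hABCD_v.vertex_unique hABCD_w (by decide)
  have hva : v ≠ a := by
    rintro rfl
    exact absurd (hCD_w.unique hCD_a) (by decide)
  have hvb : v ≠ b := by
    rintro rfl
    exact absurd (hCD_w.unique hCD_b) (by decide)
  have hvc : v ≠ c := by
    rintro rfl
    exact absurd (hAB_v.unique hAB_c) (by decide)
  have hvd : v ≠ d := by
    rintro rfl
    exact absurd (hAB_v.unique hAB_d) (by decide)
  have hblocked : ∀ {X Y Z : FeasibleSet} {y z : V}, Step e X y Y → Step e X z Z → X < Y → X < Z →
      (∀ T, X < T → Y ≤ T ∨ Z ≤ T) → v ≠ y → v ≠ z → ¬ Firable E (e X).val v := by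
    intro X Y Z y z hy hz hXY hXZ hcov hvy hvz hv
    obtain ⟨T, hT⟩ := exists_step_of_firable hv
    have hXT : X ≠ T := hAB_v.ne_of_ne hT (by decide)
    have hw := hT.wcovBy he
    rcases hcov T (lt_of_le_of_ne hw.le hXT) with h | h
    · obtain rfl := (hw.eq_or_eq hXY.le h).resolve_left hXY.ne'
      exact hvy (hT.vertex_unique hy hXT)
    · obtain rfl := (hw.eq_or_eq hXZ.le h).resolve_left hXZ.ne'
      exact hvz (hT.vertex_unique hz hXT)
  have hAC : ¬ Firable E (e AC).val v :=
    hblocked hAC_b hAC_d (by decide) (by decide) (by decide) hvb hvd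
  have hBD : ¬ Firable E (e BD).val v :=
    hblocked hBD_a hBD_c (by decide) (by decide) (by decide) hva hvc
  have hAB := hAB_v.1
  have hCD := hCD_w.1
  unfold Firable at hAB hCD hAC hBD
  rw [hA_b.2, hO_a.2, fire_apply_of_ne _ hvb, fire_apply_of_ne _ hva] at hAB
  rw [hC_d.2, hO_c.2, fire_apply_of_ne _ hvd, fire_apply_of_ne _ hvc] at hCD
  rw [hA_c.2, hO_a.2, fire_apply_of_ne _ hvc, fire_apply_of_ne _ hva] at hAC
  rw [hB_d.2, hO_b.2, fire_apply_of_ne _ hvd, fire_apply_of_ne _ hvb] at hBD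
  omega

end FeasibleSet

/-- there exists a finite upper locally distributive lattice that is not
order-isomorphic to the configuration space of any convergent chip firing game. -/
theorem exists_ULD_not_CFGSpace :
    ∃ (L : Type) (i1 : Lattice L) (i2 : Fintype L) (i3 : Nonempty L),
      IsULD L ∧ ¬ CFGSpace L := by
  exact ⟨FeasibleSet, inferInstance, inferInstance, ⟨⟨∅, by decide⟩⟩,
    FeasibleSet.isULD, FeasibleSet.not_CFGSpace⟩
end

section
/- Let L be a finite upper locally distributive lattice with set J of join-irreducibles. If x, y ∈ L satisfy J_x ⊆ J_y and J_x ~ J_y, then x = y. -/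
/-- An element of a lattice is join-irreducible if it has exactly one lower cover. -/
def JoinIrred {L : Type*} [Lattice L] (j : L) : Prop := ∃! a : L, a ⋖ j

/-- An element of a lattice is meet-irreducible if it has exactly one upper cover. -/
def MeetIrred {L : Type*} [Lattice L] (m : L) : Prop := ∃! b : L, m ⋖ b

/-- `UpDown j m` is the relation `j ↕ m`: `j ≰ m`, `j⁻ ≤ m` (every lower cover of `j`
is below `m`) and `j ≤ m⁺` (`j` is below every upper cover of `m`). -/
def UpDown {L : Type*} [Lattice L] (j m : L) : Prop :=
  ¬ j ≤ m ∧ (∀ a : L, a ⋖ j → a ≤ m) ∧ (∀ b : L, m ⋖ b → j ≤ b)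

/-- Two join-irreducibles are `~`-equivalent if they share the same meet-irreducible `m`
with `j ↕ m` (in a ULD lattice, the `m` with `j ↕ m` is unique for each `j`). -/
def SimJ {L : Type*} [Lattice L] (j j' : L) : Prop :=
  ∃ m : L, MeetIrred m ∧ UpDown j m ∧ UpDown j' m

/-- `Jset x` is the set `J_x` of join-irreducibles below `x`. -/
def Jset {L : Type*} [Lattice L] (x : L) : Set L := {j : L | JoinIrred j ∧ j ≤ x}

/-- `X ~ Y` for sets of join-irreducibles: every element of `X \ Y` is `~`-equivalent to
some element of `Y` and conversely. -/
def SetSim {L : Type*} [Lattice L] (X Y : Set L) : Prop :=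
  (∀ j ∈ X \ Y, ∃ j' ∈ Y, SimJ j j') ∧ (∀ j ∈ Y \ X, ∃ j' ∈ X, SimJ j j')

theorem le_covJoin {L : Type*} [Lattice L] [Fintype L] (x : L) : x ≤ covJoin x := by
  classical
  exact Finset.le_sup' (s := insert x (Finset.univ.filter (fun y => x ⋖ y))) (f := id) (by simp)

theorem CovBy.le_covJoin {L : Type*} [Lattice L] [Fintype L] {x y : L} (h : x ⋖ y) :
    y ≤ covJoin x := by
  classical
  exact Finset.le_sup' (s := insert x (Finset.univ.filter (fun y => x ⋖ y))) (f := id)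
    (by simp [h])

/-- An interval order-isomorphic to a powerset is distributive. -/
theorem inf_sup_le_of_Icc_orderIso {L S : Type*} [Lattice L] {c d : L}
    (φ : Set.Icc c d ≃o Set S) {u v w : L} (hu : u ∈ Set.Icc c d) (hv : v ∈ Set.Icc c d)
    (hw : w ∈ Set.Icc c d) : u ⊓ (v ⊔ w) ≤ (u ⊓ v) ⊔ (u ⊓ w) := by
  have key : (⟨u, hu⟩ : Set.Icc c d) ⊓ (⟨v, hv⟩ ⊔ ⟨w, hw⟩) ≤
      (⟨u, hu⟩ ⊓ ⟨v, hv⟩) ⊔ (⟨u, hu⟩ ⊓ ⟨w, hw⟩) := by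
    rw [← φ.le_iff_le]
    simp only [OrderIso.map_inf, OrderIso.map_sup]
    exact inf_sup_left _ _ _ |>.le
  exact key

theorem CovBy.inf_eq_of_not_le {L : Type*} [Lattice L] {c p q : L} (hp : c ⋖ p) (hq : c ≤ q)
    (h : ¬ p ≤ q) : p ⊓ q = c :=
  (hp.eq_or_eq (le_inf hp.le hq) inf_le_left).resolve_right fun e => h (inf_eq_left.1 e)

section ULD

variable {L : Type*} [Lattice L] [Fintype L]

/-- Any three elements between `c` and the join of its upper covers satisfy the distributive
law. -/
theorem IsULD.inf_sup_le (hULD : IsULD L) {c u v w : L} (hu : u ∈ Set.Icc c (covJoin c))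
    (hv : v ∈ Set.Icc c (covJoin c)) (hw : w ∈ Set.Icc c (covJoin c)) :
    u ⊓ (v ⊔ w) ≤ (u ⊓ v) ⊔ (u ⊓ w) :=
  let ⟨φ⟩ := hULD c
  inf_sup_le_of_Icc_orderIso φ hu hv hw

theorem IsULD.not_le_sup_of_covBy (hULD : IsULD L) {c p q r : L} (hp : c ⋖ p) (hq : c ⋖ q)
    (hr : c ⋖ r) (hpq : ¬ p ≤ q) (hpr : ¬ p ≤ r) : ¬ p ≤ q ⊔ r := by
  intro h
  have h1 := hULD.inf_sup_le ⟨hp.le, hp.le_covJoin⟩ ⟨hq.le, hq.le_covJoin⟩ ⟨hr.le, hr.le_covJoin⟩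
  rw [hp.inf_eq_of_not_le hq.le hpq, hp.inf_eq_of_not_le hr.le hpr, inf_eq_left.2 h, sup_idem] at h1
  exact hp.lt.not_ge h1

theorem IsULD.covBy_sup (hULD : IsULD L) {c p q : L} (hp : c ⋖ p) (hq : c ⋖ q)
    (hpq : ¬ p ≤ q) : q ⋖ p ⊔ q := by
  refine ⟨lt_of_le_of_ne le_sup_right fun e => hpq (e ▸ le_sup_left), fun t hqt htp => ?_⟩
  have h1 := hULD.inf_sup_le (u := t)
    ⟨hq.le.trans hqt.le, htp.le.trans (sup_le hp.le_covJoin hq.le_covJoin)⟩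
    ⟨hp.le, hp.le_covJoin⟩ ⟨hq.le, hq.le_covJoin⟩
  rw [inf_eq_left.2 htp.le, inf_eq_right.2 hqt.le, inf_comm] at h1
  by_cases h : p ≤ t
  · exact htp.not_ge (sup_le h hqt.le)
  · rw [hp.inf_eq_of_not_le (hq.le.trans hqt.le) h, sup_eq_right.2 hq.le] at h1
    exact hqt.not_ge h1

/-- If `p` covers `c`, the elements above `c` that are not above `p` are closed under joins. -/
theorem IsULD.not_le_sup (hULD : IsULD L) {c p a b : L} (hp : c ⋖ p) (ha : c ≤ a) (hb : c ≤ b)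
    (hpa : ¬ p ≤ a) (hpb : ¬ p ≤ b) : ¬ p ≤ a ⊔ b := by
  induction c using WellFoundedGT.induction generalizing p a b with
  | ind c ih =>
  rcases ha.eq_or_lt with rfl | ha
  · rwa [sup_eq_right.2 hb]
  rcases hb.eq_or_lt with rfl | hb
  · rwa [sup_eq_left.2 ha.le]
  obtain ⟨q, hq, hqa⟩ := exists_covBy_le_of_lt ha
  obtain ⟨r, hr, hrb⟩ := exists_covBy_le_of_lt hb
  have hpq : ¬ p ≤ q := fun h => hpa (h.trans hqa)
  have hpr : ¬ p ≤ r := fun h => hpb (h.trans hrb)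
  have hqb : ¬ p ≤ q ⊔ b := by
    have h := ih r hr.lt (hULD.covBy_sup hp hr hpr) (a := q ⊔ r) (b := b) le_sup_right hrb
      (fun h => hULD.not_le_sup_of_covBy hp hq hr hpq hpr (le_sup_left.trans h))
      (fun h => hpb (le_sup_left.trans h))
    exact fun h' => h (sup_le (h'.trans (sup_le_sup_right le_sup_left b))
      (hrb.trans le_sup_right))
  have h := ih q hq.lt (hULD.covBy_sup hp hq hpq) (a := a) (b := q ⊔ b) hqa le_sup_left
    (fun h => hpa (le_sup_left.trans h)) (fun h => hqb (le_sup_left.trans h))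
  exact fun h' => h (sup_le (h'.trans (sup_le_sup_left le_sup_right a)) (hqa.trans le_sup_left))

end ULD

/-- If `y ≰ x`, some join-irreducible `j ≤ y` is not below `x` while its lower cover is. -/
theorem exists_mem_Jset_of_not_le {L : Type*} [Lattice L] [Finite L] {x y : L} (h : ¬ y ≤ x) :
    ∃ j ∈ Jset y, ¬ j ≤ x ∧ j ⊓ x ⋖ j := by
  obtain ⟨j, hjy, hj⟩ := (Set.toFinite {j : L | ¬ j ≤ x}).exists_le_minimal h
  have hlt : ∀ t < j, t ≤ j ⊓ x := fun t ht =>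
    le_inf ht.le (by_contra fun hx => hj.not_prop_of_lt ht hx)
  have hcov : j ⊓ x ⋖ j :=
    ⟨inf_lt_left.2 hj.prop, fun t h1 h2 => h1.not_ge (hlt t h2)⟩
  exact ⟨j, ⟨⟨_, hcov, fun a ha => (ha.eq_or_eq (hlt a ha.lt) hcov.le).resolve_right
    hcov.ne |>.symm⟩, hjy⟩, hj.prop, hcov⟩

/-- in a finite ULD lattice, if `J_x ⊆ J_y` and `J_x ~ J_y`, then
`x = y`. -/
theorem eq_of_Jset_subset_sim {L : Type*} [Lattice L] [Fintype L] (hULD : IsULD L)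
    (x y : L) (hsub : Jset x ⊆ Jset y) (hsim : SetSim (Jset x) (Jset y)) : x = y := by
  have hxy : x ≤ y := by
    by_contra h
    obtain ⟨j, hjx, hjy, -⟩ := exists_mem_Jset_of_not_le h
    exact hjy (hsub hjx).2
  refine le_antisymm hxy (by_contra fun h => ?_)
  obtain ⟨j, hjy, hjx, hcov⟩ := exists_mem_Jset_of_not_le h
  obtain ⟨j', hj'x, m, -, ⟨hjm, hlow, hup⟩, ⟨hj'm, -, -⟩⟩ := hsim.2 j ⟨hjy, fun hj => hjx hj.2⟩
  have hlt : m < m ⊔ x := left_lt_sup.2 fun hxm => hj'm (hj'x.2.trans hxm)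
  obtain ⟨b, hmb, hb⟩ := exists_covBy_le_of_lt hlt
  exact hULD.not_le_sup hcov (hlow _ hcov) inf_le_right hjm hjx ((hup b hmb).trans hb)
end
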